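/- arXiv:1612.08821 — 7 statements merged into one kernel-verified Lean document; each statement's English description precedes it below -/
import Mathlib

section
/- Let (Ω, μ) be a probability space and X, Y, Ỹ : Ω → [0,∞) integrable random variables with max(X,Y) and max(X,Ỹ) integrable. Suppose (i) X and Y are positively correlated, i.e., for every x, y: μ(X > x and Y > y) ≥ μ(X > x)·μ(Y > y); (ii) Ỹ is independent of X; and (iii) Ỹ first-order stochastically dominates Y, i.e., for every x: μ(Ỹ > x) ≥ μ(Y > x). Then E[max(X, Y)] ≤ E[max(X, Ỹ)]. -/
open MeasureTheory ProbabilityTheory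
open scoped ENNReal

/-- For nonnegative functions, a pointwise inequality between tail measures implies the
inequality between integrals. -/
theorem integral_le_integral_of_measure_lt_le {α : Type*} [MeasurableSpace α] {μ : Measure α}
    {f g : α → ℝ} (hf : 0 ≤ᵐ[μ] f) (hg : 0 ≤ᵐ[μ] g) (hfm : AEStronglyMeasurable f μ)
    (hgi : Integrable g μ) (h : ∀ t : ℝ, μ {a | t < f a} ≤ μ {a | t < g a}) :
    ∫ a, f a ∂μ ≤ ∫ a, g a ∂μ := by
  rw [integral_eq_lintegral_of_nonneg_ae hf hfm,
    integral_eq_lintegral_of_nonneg_ae hg hgi.aestronglyMeasurable]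
  refine ENNReal.toReal_mono hgi.lintegral_lt_top.ne ?_
  rw [lintegral_eq_lintegral_meas_lt μ hf hfm.aemeasurable,
    lintegral_eq_lintegral_meas_lt μ hg hgi.aemeasurable]
  exact lintegral_mono fun t => h t

/-- If `A` and `B` are positively correlated events, `A` and `C` are independent, and `C` is at
least as likely as `B`, then `A ∪ C` is at least as likely as `A ∪ B`. -/
theorem measure_union_le_of_posCorr_of_indep {Ω : Type*} [MeasurableSpace Ω] {μ : Measure Ω}
    [IsProbabilityMeasure μ] {A B C : Set Ω} (hB : MeasurableSet B) (hC : MeasurableSet C)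
    (hAB : μ A * μ B ≤ μ (A ∩ B)) (hAC : μ (A ∩ C) = μ A * μ C) (hBC : μ B ≤ μ C) :
    μ (A ∪ B) ≤ μ (A ∪ C) := by
  have hAB' : μ.real A * μ.real B ≤ μ.real (A ∩ B) := by
    simpa [measureReal_def] using ENNReal.toReal_mono (measure_ne_top μ _) hAB
  have hAC' : μ.real (A ∩ C) = μ.real A * μ.real C := by
    simp [measureReal_def, hAC]
  have hBC' : μ.real B ≤ μ.real C := ENNReal.toReal_mono (measure_ne_top μ _) hBC
  have hB' := measureReal_union_add_inter (μ := μ) (s := A) hB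
  have hC' := measureReal_union_add_inter (μ := μ) (s := A) hC
  have hA : μ.real A ≤ 1 := measureReal_le_one
  refine (ENNReal.toReal_le_toReal (measure_ne_top μ _) (measure_ne_top μ _)).1 ?_
  change μ.real (A ∪ B) ≤ μ.real (A ∪ C)
  nlinarith [mul_nonneg (sub_nonneg.2 hA) (sub_nonneg.2 hBC')]

/-- Lemma B.1 (lem:corr): if `X, Y` are positively correlated nonnegative random
variables, and `Ỹ` is independent of `X` and first-order stochastically dominates `Y`,
then `E[max(X,Y)] ≤ E[max(X,Ỹ)]`. -/
theorem stmt3 {Ω : Type*} [MeasurableSpace Ω] (μ : Measure Ω) [IsProbabilityMeasure μ]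
    (X Y Yt : Ω → ℝ)
    (hXmeas : Measurable X) (hYmeas : Measurable Y) (hYtmeas : Measurable Yt)
    (hXpos : ∀ ω, 0 ≤ X ω) (hYpos : ∀ ω, 0 ≤ Y ω) (hYtpos : ∀ ω, 0 ≤ Yt ω)
    (hXint : Integrable X μ) (hYint : Integrable Y μ) (hYtint : Integrable Yt μ)
    (hmaxint : Integrable (fun ω => max (X ω) (Y ω)) μ)
    (hmaxint' : Integrable (fun ω => max (X ω) (Yt ω)) μ)
    (hposcorr : ∀ x y : ℝ,
      μ {ω | x < X ω} * μ {ω | y < Y ω} ≤ μ ({ω | x < X ω} ∩ {ω | y < Y ω}))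
    (hindep : IndepFun Yt X μ)
    (hfosd : ∀ x : ℝ, μ {ω | x < Y ω} ≤ μ {ω | x < Yt ω}) :
    ∫ ω, max (X ω) (Y ω) ∂μ ≤ ∫ ω, max (X ω) (Yt ω) ∂μ := by
  refine integral_le_integral_of_measure_lt_le (.of_forall fun ω => le_max_of_le_left (hXpos ω))
    (.of_forall fun ω => le_max_of_le_left (hXpos ω)) hmaxint.aestronglyMeasurable hmaxint'
    fun t => ?_
  simp only [lt_max_iff, Set.ofPred_or]
  exact measure_union_le_of_posCorr_of_indep (measurableSet_lt measurable_const hYmeas)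
    (measurableSet_lt measurable_const hYtmeas) (hposcorr t t)
    (hindep.symm.measure_inter_preimage_eq_mul (Set.Ioi t) (Set.Ioi t) measurableSet_Ioi
      measurableSet_Ioi) (hfosd t)
end

section
/- Consider a finite set of bidders with a common downward-closed feasibility family 𝕀 containing every singleton, strictly positive item values v_{ij} over m items, and strictly more bidders than items. Let S* be a welfare-maximizing allocation (which then allocates every item), let Ā be the set of bidders receiving no item under S*, and for each item j let v*_j = max_{i ∈ Ā} v_{ij}. Then the VCG revenue at S* is at least Σ_{j=1}^m v*_j. -/
open MeasureTheory Finset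
open scoped Classical BigOperators

/-- `S` is an allocation of the `m` items to the `N` bidders, where each bidder `i`
must receive a set feasible for its feasibility family `I i`. -/
def IsAlloc {N m : ℕ} (I : Fin N → Set (Finset (Fin m)))
    (S : Fin N → Finset (Fin m)) : Prop :=
  (∀ i, S i ∈ I i) ∧ ∀ i i' : Fin N, i ≠ i' → Disjoint (S i) (S i')

/-- The welfare of an allocation. -/
def welfare {N m : ℕ} (v : Fin N → Fin m → ℝ) (S : Fin N → Finset (Fin m)) : ℝ :=
  ∑ i, ∑ j ∈ S i, v i j

/-- `S` is a welfare-maximizing allocation. -/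
def IsMaxAlloc {N m : ℕ} (I : Fin N → Set (Finset (Fin m)))
    (v : Fin N → Fin m → ℝ) (S : Fin N → Finset (Fin m)) : Prop :=
  IsAlloc I S ∧ ∀ S', IsAlloc I S' → welfare v S' ≤ welfare v S

/-- The maximum welfare achievable by allocating only to the bidders other than `i`. -/
noncomputable def maxWelfareWithout {N m : ℕ} (I : Fin N → Set (Finset (Fin m)))
    (v : Fin N → Fin m → ℝ) (i : Fin N) : ℝ :=
  sSup {w : ℝ | ∃ S, IsAlloc I S ∧ S i = ∅ ∧ w = welfare v S}

/-- The VCG revenue at allocation `S`: each bidder `i` pays its externality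
`maxWelfareWithout i - Σ_{i' ≠ i} Σ_{j ∈ S i'} v i' j`. -/
noncomputable def vcgRevenueAt {N m : ℕ} (I : Fin N → Set (Finset (Fin m)))
    (v : Fin N → Fin m → ℝ) (S : Fin N → Finset (Fin m)) : ℝ :=
  ∑ i, (maxWelfareWithout I v i - ∑ i' ∈ Finset.univ.erase i, ∑ j ∈ S i', v i' j)

theorem bddAbove_welfareWithout {N m : ℕ} (I : Fin N → Set (Finset (Fin m)))
    (v : Fin N → Fin m → ℝ) (i : Fin N) :
    BddAbove {w : ℝ | ∃ S, IsAlloc I S ∧ S i = ∅ ∧ w = welfare v S} :=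
  ((Set.finite_range (welfare v)).subset (by rintro _ ⟨S, -, -, rfl⟩; exact ⟨S, rfl⟩)).bddAbove

/-- With more bidders than items, some bidder receives nothing. -/
theorem exists_unallocated {N m : ℕ} (hNm : m < N) {I : Fin N → Set (Finset (Fin m))}
    {S : Fin N → Finset (Fin m)} (hS : IsAlloc I S) : ∃ i, S i = ∅ := by
  by_contra! h
  choose f hf using h
  have hinj : Function.Injective f := fun i i' hii => by
    by_contra hne
    exact disjoint_left.1 (hS.2 i i' hne) (hf i) (hii ▸ hf i')
  have := Fintype.card_le_of_injective f hinj
  simp only [Fintype.card_fin] at this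
  omega

/-- If some bidder receives nothing, a welfare-maximizing allocation allocates every item. -/
theorem IsMaxAlloc.exists_mem {N m : ℕ} {I : Set (Finset (Fin m))} {v : Fin N → Fin m → ℝ}
    {S : Fin N → Finset (Fin m)} (hS : IsMaxAlloc (fun _ => I) v S) (hv : ∀ i j, 0 < v i j)
    (hsing : ∀ j : Fin m, ({j} : Finset (Fin m)) ∈ I) {a : Fin N} (ha : S a = ∅) (j : Fin m) :
    ∃ i, j ∈ S i := by
  by_contra! hj
  refine (hS.2 (Function.update S a {j}) ⟨fun i => ?_, fun i i' h => ?_⟩).not_gt ?_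
  · by_cases hi : i = a
    · subst hi; simpa using hsing j
    · simpa [hi] using hS.1.1 i
  · by_cases hi : i = a
    · subst hi; simp [h.symm, hj]
    · by_cases hi' : i' = a
      · subst hi'; simp [h, hj]
      · simpa [hi, hi'] using hS.1.2 i i' h
  · refine sum_lt_sum (fun i _ => ?_) ⟨a, mem_univ a, by simpa [ha] using hv a j⟩
    by_cases hi : i = a
    · subst hi; simpa [ha] using (hv i j).le
    · simp [hi]

/-- Removing bidder `i` and handing each item `j` of `S i` to a bidder `k j` who receives nothing
under `S` is feasible, which bounds the optimal welfare without `i` from below. -/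
theorem IsAlloc.le_maxWelfareWithout {N m : ℕ} {I : Set (Finset (Fin m))}
    {S : Fin N → Finset (Fin m)} (hS : IsAlloc (fun _ => I) S)
    (hdc : ∀ T T' : Finset (Fin m), T ⊆ T' → T' ∈ I → T ∈ I)
    (v : Fin N → Fin m → ℝ) (k : Fin m → Fin N) (hk : ∀ j, S (k j) = ∅) (i : Fin N) :
    ∑ i' ∈ univ.erase i, ∑ j ∈ S i', v i' j + ∑ j ∈ S i, v (k j) j
      ≤ maxWelfareWithout (fun _ => I) v i := by
  let T : Fin N → Finset (Fin m) := fun i' =>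
    if i' = i then ∅ else S i' ∪ (S i).filter fun j => k j = i'
  have hdisj : ∀ i', i' ≠ i → Disjoint (S i') ((S i).filter fun j => k j = i') := fun i' h =>
    (hS.2 i' i h).mono_right (filter_subset _ _)
  refine le_csSup (bddAbove_welfareWithout _ v i) ⟨T, ⟨fun i' => ?_, fun i' i'' h => ?_⟩, ?_, ?_⟩
  · by_cases hi : i' = i
    · simpa [T, hi] using hdc ∅ (S i) (empty_subset _) (hS.1 i)
    · by_cases he : S i' = ∅
      · simpa [T, hi, he] using hdc _ (S i) (filter_subset _ _) (hS.1 i)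
      · have : (S i).filter (fun j => k j = i') = ∅ :=
          filter_eq_empty_iff.2 fun j _ hj => he (hj ▸ hk j)
        simpa [T, hi, this] using hS.1 i'
  · by_cases hi : i' = i
    · simp [T, hi]
    · by_cases hi' : i'' = i
      · simp [T, hi']
      · simp only [T, hi, hi', if_false, disjoint_union_left, disjoint_union_right]
        refine ⟨⟨hS.2 _ _ h, ?_⟩, ?_, ?_⟩
        · exact (hS.2 _ _ hi').symm.mono_left (filter_subset _ _)
        · exact (hS.2 _ _ hi).mono_right (filter_subset _ _)
        · exact disjoint_filter.2 fun j _ h₁ h₂ => h (h₁.symm.trans h₂)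
  · simp [T]
  · have hmaps : ∀ j ∈ S i, k j ∈ univ.erase i := fun j hj => by
      refine mem_erase.2 ⟨fun h => ?_, mem_univ _⟩
      have := hk j
      simp [h ▸ this] at hj
    rw [welfare, ← sum_erase (a := i) univ (by simp [T]), ← sum_fiberwise_of_maps_to hmaps,
      ← sum_add_distrib]
    refine sum_congr rfl fun i' hi' => ?_
    have hne := ne_of_mem_erase hi'
    simp only [T, hne, if_false]
    rw [sum_union (hdisj i' hne)]
    congr 1
    exact sum_congr rfl fun j hj => by rw [(mem_filter.1 hj).2]

/-- Lemma 7.3 (lem:vcg_rev): with a common downward-closed feasibility family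
containing every singleton, strictly positive values, and strictly more bidders than
items, the VCG revenue at a welfare-maximizing allocation `S` is at least
`Σ_j v*_j`, where `v*_j` is the highest value for item `j` among the bidders
that receive no item under `S`. -/
theorem stmt7 {N m : ℕ} (hNm : m < N)
    (v : Fin N → Fin m → ℝ) (hv : ∀ i j, 0 < v i j)
    (I : Set (Finset (Fin m)))
    (hdc : ∀ T T' : Finset (Fin m), T ⊆ T' → T' ∈ I → T ∈ I)
    (hsing : ∀ j : Fin m, ({j} : Finset (Fin m)) ∈ I)
    (S : Fin N → Finset (Fin m))
    (hS : IsMaxAlloc (fun _ => I) v S) :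
    (∑ j : Fin m, sSup {x : ℝ | ∃ i, S i = ∅ ∧ x = v i j})
      ≤ vcgRevenueAt (fun _ => I) v S := by
  obtain ⟨a, ha⟩ := exists_unallocated hNm hS.1
  choose k hk hmax using fun j : Fin m =>
    (univ.filter fun i => S i = ∅).exists_max_image (fun i => v i j) ⟨a, by simp [ha]⟩
  simp only [mem_filter, mem_univ, true_and] at hk hmax
  have hstar : ∀ j, sSup {x : ℝ | ∃ i, S i = ∅ ∧ x = v i j} ≤ v (k j) j := fun j =>
    csSup_le ⟨_, a, ha, rfl⟩ (by rintro _ ⟨i, hi, rfl⟩; exact hmax j i hi)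
  calc (∑ j : Fin m, sSup {x : ℝ | ∃ i, S i = ∅ ∧ x = v i j})
      ≤ ∑ j : Fin m, v (k j) j := sum_le_sum fun j _ => hstar j
    _ = ∑ i, ∑ j ∈ S i, v (k j) j := by
        rw [← sum_biUnion fun i _ i' _ h => hS.1.2 i i' h]
        refine sum_congr (Eq.symm ?_) fun _ _ => rfl
        ext j
        simpa using hS.exists_mem hv hsing ha j
    _ ≤ vcgRevenueAt (fun _ => I) v S := sum_le_sum fun i _ => by
        have := hS.1.le_maxWelfareWithout hdc v k hk i
        linarith
end

section
/- Fix an item j among the m items, and bidders with a common downward-closed feasibility family 𝕀 containing every singleton and nonnegative item values. Suppose S^{−j} is the UNIQUE welfare-maximizing allocation of the items other than j, and S is a welfare-maximizing allocation of all m items that assigns item j to a bidder i with S^{−j}_i = ∅ (i unallocated in S^{−j}). Then S_i = {j} and S_{i'} = S^{−j}_{i'} for every bidder i' ≠ i; in particular, i is the only bidder unallocated in S^{−j} who receives an item in S. -/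
open MeasureTheory Finset
open scoped Classical BigOperators

/-- `S` is an allocation of (some of) the items in `J` to the `N` bidders, where each
bidder receives a set feasible for the common feasibility family `I`. -/
def IsAllocOn {N m : ℕ} (J : Finset (Fin m)) (I : Set (Finset (Fin m)))
    (S : Fin N → Finset (Fin m)) : Prop :=
  (∀ i, S i ∈ I) ∧ (∀ i, S i ⊆ J) ∧ ∀ i i' : Fin N, i ≠ i' → Disjoint (S i) (S i')

theorem welfare_update {N m : ℕ} (v : Fin N → Fin m → ℝ) (S : Fin N → Finset (Fin m))
    (i : Fin N) (A : Finset (Fin m)) :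
    welfare v (Function.update S i A) = welfare v S - ∑ k ∈ S i, v i k + ∑ k ∈ A, v i k := by
  unfold welfare
  rw [← Finset.add_sum_erase _ _ (Finset.mem_univ i),
    ← Finset.add_sum_erase _ (fun i => ∑ k ∈ S i, v i k) (Finset.mem_univ i)]
  have h : ∀ i' ∈ Finset.univ.erase i,
      ∑ k ∈ Function.update S i A i', v i' k = ∑ k ∈ S i', v i' k := by
    intro i' hi'
    rw [Function.update_of_ne (Finset.ne_of_mem_erase hi')]
  rw [Finset.sum_congr rfl h, Function.update_self]
  ring

theorem IsAllocOn.update {N m : ℕ} {J K : Finset (Fin m)} {I : Set (Finset (Fin m))}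
    {S : Fin N → Finset (Fin m)} (hS : IsAllocOn J I S) {i : Fin N} {A : Finset (Fin m)}
    (hA : A ∈ I) (hAK : A ⊆ K) (hK : ∀ i', i' ≠ i → S i' ⊆ K)
    (hdisj : ∀ i', i' ≠ i → Disjoint A (S i')) :
    IsAllocOn K I (Function.update S i A) := by
  refine ⟨fun a => ?_, fun a => ?_, fun a b hab => ?_⟩
  · by_cases ha : a = i
    · subst ha
      simpa using hA
    · simpa [ha] using hS.1 a
  · by_cases ha : a = i
    · subst ha
      simpa using hAK
    · simpa [ha] using hK a ha
  · by_cases ha : a = i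
    · subst ha
      simpa [hab.symm] using hdisj b hab.symm
    · by_cases hb : b = i
      · subst hb
        simpa [ha] using (hdisj a ha).symm
      · simpa [ha, hb] using hS.2.2 a b hab

/-- Claim 7.5 (clm:single_allocated): if `Smj` is the unique welfare-maximizing
allocation of the items other than `j`, and `S` is a welfare-maximizing allocation
of all the items assigning item `j` to a bidder `i` unallocated under `Smj`,
then `S i = {j}` and every other bidder gets exactly its `Smj`-allocation;
in particular `i` is the only bidder unallocated in `Smj` receiving an item in `S`. -/
theorem stmt8 {N m : ℕ}
    (v : Fin N → Fin m → ℝ) (hv : ∀ i j, 0 ≤ v i j)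
    (I : Set (Finset (Fin m)))
    (hdc : ∀ T T' : Finset (Fin m), T ⊆ T' → T' ∈ I → T ∈ I)
    (hsing : ∀ j : Fin m, ({j} : Finset (Fin m)) ∈ I)
    (j : Fin m)
    (Smj : Fin N → Finset (Fin m))
    (hSmj : IsAllocOn (Finset.univ.erase j) I Smj)
    (hSmjMax : ∀ S', IsAllocOn (Finset.univ.erase j) I S' → welfare v S' ≤ welfare v Smj)
    (hSmjUniq : ∀ S', IsAllocOn (Finset.univ.erase j) I S' →
      welfare v S' = welfare v Smj → S' = Smj)
    (S : Fin N → Finset (Fin m))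
    (hS : IsAllocOn Finset.univ I S)
    (hSMax : ∀ S', IsAllocOn Finset.univ I S' → welfare v S' ≤ welfare v S)
    (i : Fin N) (hiUnalloc : Smj i = ∅) (hij : j ∈ S i) :
    S i = {j} ∧ ∀ i', i' ≠ i → S i' = Smj i' := by
  have hj : ∀ i', i' ≠ i → j ∉ S i' := fun i' hi' h =>
    Finset.disjoint_left.mp (hS.2.2 i' i hi') h hij
  have hT : IsAllocOn (Finset.univ.erase j) I (Function.update S i ((S i).erase j)) :=
    hS.update (hdc _ _ (Finset.erase_subset _ _) (hS.1 i))
      (Finset.erase_subset_erase _ (Finset.subset_univ _))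
      (fun i' hi' => Finset.subset_erase.mpr ⟨Finset.subset_univ _, hj i' hi'⟩)
      (fun i' hi' => (hS.2.2 i i' hi'.symm).mono_left (Finset.erase_subset _ _))
  have hU : IsAllocOn Finset.univ I (Function.update Smj i {j}) :=
    hSmj.update (hsing j) (Finset.subset_univ _) (fun _ _ => Finset.subset_univ _)
      (fun i' _ => Finset.disjoint_singleton_left.mpr
        fun h => Finset.notMem_erase j _ (hSmj.2.1 i' h))
  have hle := hSMax _ hU
  rw [welfare_update, hiUnalloc, Finset.sum_empty, Finset.sum_singleton] at hle
  have hW := welfare_update v S i ((S i).erase j)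
  rw [← Finset.add_sum_erase (S i) (v i) hij] at hW
  have hEq := hSmjUniq _ hT (le_antisymm (hSmjMax _ hT) (by linarith))
  refine ⟨?_, fun i' hi' => ?_⟩
  · have h := congrFun hEq i
    rw [Function.update_self, hiUnalloc] at h
    rw [← Finset.insert_erase hij, h]
    rfl
  · simpa [hi'] using congrFun hEq i'
end

section
/- Fix an item j among the m items, and bidders with a common downward-closed feasibility family 𝕀 containing every singleton and nonnegative item values. Suppose S^{−j} is the UNIQUE welfare-maximizing allocation of the items other than j, and let A be the set of bidders receiving at least one item under S^{−j} (so |A| ≤ m − 1). Let S be the unique welfare-maximizing allocation of all m items among those allocations that assign item j to some bidder of A. Then the bidders in A collectively receive at least |A| items under S; consequently, at most m − |A| items are allocated by S to bidders outside A. -/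
open MeasureTheory Finset
open scoped Classical BigOperators

/-- Link `a` and `b` in `A` whenever `S a` meets `T b`. Then any `i₀ ∈ A` lies in a set `C ⊆ A`
without links to `A \ C` and spanned by links given by at least `|C| - 1` elements. -/
lemma exists_closed_card_le {ι α : Type*} [DecidableEq ι] [DecidableEq α]
    {S T : ι → Finset α} (hS : ∀ i i', i ≠ i' → Disjoint (S i) (S i'))
    (hT : ∀ i i', i ≠ i' → Disjoint (T i) (T i')) {A : Finset ι} {i₀ : ι} (hi₀ : i₀ ∈ A) :
    ∃ C ⊆ A, i₀ ∈ C ∧ C.card ≤ (C.biUnion S ∩ C.biUnion T).card + 1 ∧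
      ∀ b ∈ A \ C, ∀ c ∈ C, Disjoint (S b) (T c) ∧ Disjoint (T b) (S c) := by
  obtain ⟨C, hC, hmax⟩ := (A.powerset.filter fun C =>
      i₀ ∈ C ∧ C.card ≤ (C.biUnion S ∩ C.biUnion T).card + 1).exists_max_image Finset.card
    ⟨{i₀}, by simp [hi₀]⟩
  simp only [mem_filter, mem_powerset] at hC hmax
  obtain ⟨hCA, hiC, hcard⟩ := hC
  refine ⟨C, hCA, hiC, hcard, fun b hb c hc => ?_⟩
  obtain ⟨hbA, hbC⟩ := mem_sdiff.mp hb
  have closed : ∀ k ∈ (insert b C).biUnion S ∩ (insert b C).biUnion T,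
      k ∈ C.biUnion S ∩ C.biUnion T := by
    intro k hk
    by_contra hkC
    have hlt : (C.biUnion S ∩ C.biUnion T).card <
        ((insert b C).biUnion S ∩ (insert b C).biUnion T).card :=
      card_lt_card ((ssubset_iff_of_subset (inter_subset_inter
        (biUnion_subset_biUnion_of_subset_left _ (subset_insert _ _))
        (biUnion_subset_biUnion_of_subset_left _ (subset_insert _ _)))).mpr ⟨k, hk, hkC⟩)
    have hins := card_insert_of_notMem hbC
    have := hmax (insert b C) ⟨insert_subset hbA hCA, mem_insert_of_mem hiC, by omega⟩
    omega
  have notMem : ∀ {U : ι → Finset α}, (∀ i i', i ≠ i' → Disjoint (U i) (U i')) →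
      ∀ {k}, k ∈ U b → k ∉ C.biUnion U := by
    intro U hU k hkb hk
    obtain ⟨c', hc', hkc'⟩ := mem_biUnion.mp hk
    exact disjoint_left.mp (hU b c' (ne_of_mem_of_not_mem hc' hbC).symm) hkb hkc'
  constructor <;> refine disjoint_left.mpr fun k hkb hkc => ?_
  · refine notMem hS hkb (mem_inter.mp (closed k (mem_inter.mpr ⟨?_, ?_⟩))).1
    · exact mem_biUnion.mpr ⟨b, mem_insert_self _ _, hkb⟩
    · exact mem_biUnion.mpr ⟨c, mem_insert_of_mem hc, hkc⟩
  · refine notMem hT hkb (mem_inter.mp (closed k (mem_inter.mpr ⟨?_, ?_⟩))).2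
    · exact mem_biUnion.mpr ⟨c, mem_insert_of_mem hc, hkc⟩
    · exact mem_biUnion.mpr ⟨b, mem_insert_self _ _, hkb⟩

/-- The allocation obtained from `S` by giving the bidders in `B` their bundles under `T`,
taking the items of these bundles away from everybody else. -/
def reassign {N m : ℕ} (S T : Fin N → Finset (Fin m)) (B : Finset (Fin N)) :
    Fin N → Finset (Fin m) :=
  fun i => if i ∈ B then T i else S i \ B.biUnion T

/-- The counterpart of `reassign S T B`: the bidders in `B` get their bundles under `S`, those
in `C` keep their bundles under `T`, and everybody else gets the items of `S` which
`reassign S T B` takes away. -/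
def coreassign {N m : ℕ} (S T : Fin N → Finset (Fin m)) (B C : Finset (Fin N)) :
    Fin N → Finset (Fin m) :=
  fun i => if i ∈ B then S i else if i ∈ C then T i else S i ∩ B.biUnion T

lemma isAllocOn_reassign {N m : ℕ} {J : Finset (Fin m)} {I : Set (Finset (Fin m))}
    (hdc : ∀ T T' : Finset (Fin m), T ⊆ T' → T' ∈ I → T ∈ I)
    {S T : Fin N → Finset (Fin m)} (hS : IsAllocOn J I S) (hT : IsAllocOn J I T)
    (B : Finset (Fin N)) : IsAllocOn J I (reassign S T B) := by
  refine ⟨fun i => ?_, fun i => ?_, fun i i' hne => ?_⟩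
  · unfold reassign
    split_ifs
    · exact hT.1 i
    · exact hdc _ _ sdiff_subset (hS.1 i)
  · unfold reassign
    split_ifs
    · exact hT.2.1 i
    · exact sdiff_subset.trans (hS.2.1 i)
  · unfold reassign
    split_ifs with hi hi' hi'
    · exact hT.2.2 i i' hne
    · exact disjoint_sdiff.mono_left (subset_biUnion_of_mem T hi)
    · exact (disjoint_sdiff.mono_left (subset_biUnion_of_mem T hi')).symm
    · exact (hS.2.2 i i' hne).mono sdiff_subset sdiff_subset

lemma isAllocOn_coreassign {N m : ℕ} {J K : Finset (Fin m)} {I : Set (Finset (Fin m))}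
    (hdc : ∀ T T' : Finset (Fin m), T ⊆ T' → T' ∈ I → T ∈ I)
    {S T : Fin N → Finset (Fin m)} (hS : IsAllocOn K I S) (hT : IsAllocOn J I T)
    {B C : Finset (Fin N)} (hSJ : ∀ b ∈ B, S b ⊆ J) (hBC : Disjoint B C)
    (hST : ∀ b ∈ B, ∀ c ∈ C, Disjoint (S b) (T c)) :
    IsAllocOn J I (coreassign S T B C) := by
  have hTC : ∀ c ∈ C, Disjoint (T c) (B.biUnion T) := fun c hc =>
    (disjoint_biUnion_right _ _ _).mpr fun b hb =>
      hT.2.2 c b (ne_of_mem_of_not_mem hb (disjoint_right.mp hBC hc)).symm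
  refine ⟨fun i => ?_, fun i => ?_, fun i i' hne => ?_⟩
  · unfold coreassign
    split_ifs
    · exact hS.1 i
    · exact hT.1 i
    · exact hdc _ _ inter_subset_left (hS.1 i)
  · unfold coreassign
    split_ifs with hi
    · exact hSJ i hi
    · exact hT.2.1 i
    · exact inter_subset_right.trans (biUnion_subset.mpr fun b _ => hT.2.1 b)
  · unfold coreassign
    split_ifs with hi hi' hi'C hiC hi' hi'C hi' hi'C
    · exact hS.2.2 i i' hne
    · exact hST i hi i' hi'C
    · exact (hS.2.2 i i' hne).mono_right inter_subset_left
    · exact (hST i' hi' i hiC).symm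
    · exact hT.2.2 i i' hne
    · exact (hTC i hiC).mono_right inter_subset_right
    · exact (hS.2.2 i i' hne).mono_left inter_subset_left
    · exact ((hTC i' hi'C).mono_right inter_subset_right).symm
    · exact (hS.2.2 i i' hne).mono inter_subset_left inter_subset_left

lemma welfare_reassign_add_welfare_coreassign {N m : ℕ} (v : Fin N → Fin m → ℝ)
    {S T : Fin N → Finset (Fin m)} {B C : Finset (Fin N)}
    (hTS : ∀ b ∈ B, ∀ c ∈ C, Disjoint (T b) (S c))
    (hempty : ∀ i, i ∉ B → i ∉ C → T i = ∅) :
    welfare v (reassign S T B) + welfare v (coreassign S T B C) =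
      welfare v S + welfare v T := by
  unfold welfare
  rw [← sum_add_distrib, ← sum_add_distrib]
  refine sum_congr rfl fun i _ => ?_
  unfold reassign coreassign
  split_ifs with hB hC
  · exact add_comm _ _
  · rw [sdiff_eq_self_of_disjoint ((disjoint_biUnion_right _ _ _).mpr
      fun b hb => (hTS b hb i hC).symm)]
  · rw [hempty i hB hC, sum_empty, add_zero, add_comm, sum_inter_add_sum_sdiff]

/-- Claim 7.6 (clm:unallocated, the charging claim): let `Smj` be the unique
welfare-maximizing allocation of the items other than `j`, let `A` be the set of
bidders allocated under `Smj`, and let `S` be the unique welfare-maximizing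
allocation of all `m` items among those assigning item `j` to a bidder of `A`.
Then the bidders of `A` collectively receive at least `|A|` items under `S`;
consequently at most `m - |A|` items are allocated by `S` to bidders outside `A`. -/
theorem stmt9 {N m : ℕ}
    (v : Fin N → Fin m → ℝ) (hv : ∀ i j, 0 ≤ v i j)
    (I : Set (Finset (Fin m)))
    (hdc : ∀ T T' : Finset (Fin m), T ⊆ T' → T' ∈ I → T ∈ I)
    (hsing : ∀ j : Fin m, ({j} : Finset (Fin m)) ∈ I)
    (j : Fin m)
    (Smj : Fin N → Finset (Fin m))
    (hSmj : IsAllocOn (Finset.univ.erase j) I Smj)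
    (hSmjMax : ∀ S', IsAllocOn (Finset.univ.erase j) I S' → welfare v S' ≤ welfare v Smj)
    (hSmjUniq : ∀ S', IsAllocOn (Finset.univ.erase j) I S' →
      welfare v S' = welfare v Smj → S' = Smj)
    (A : Finset (Fin N)) (hA : A = Finset.univ.filter fun i => Smj i ≠ ∅)
    (S : Fin N → Finset (Fin m))
    (hS : IsAllocOn Finset.univ I S) (hSj : ∃ i ∈ A, j ∈ S i)
    (hSMax : ∀ S', IsAllocOn Finset.univ I S' → (∃ i ∈ A, j ∈ S' i) →
      welfare v S' ≤ welfare v S)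
    (hSUniq : ∀ S', IsAllocOn Finset.univ I S' → (∃ i ∈ A, j ∈ S' i) →
      welfare v S' = welfare v S → S' = S) :
    A.card ≤ ∑ i ∈ A, (S i).card ∧
      (∑ i ∈ Finset.univ \ A, (S i).card) ≤ m - A.card := by
  obtain ⟨i₀, hi₀A, hji₀⟩ := hSj
  have hjT : ∀ i, j ∉ Smj i := fun i h => by simpa using hSmj.2.1 i h
  have hSmj' : IsAllocOn Finset.univ I Smj := ⟨hSmj.1, fun i => subset_univ _, hSmj.2.2⟩
  obtain ⟨C, hCA, hi₀C, hcard, hclosed⟩ := exists_closed_card_le hS.2.2 hSmj.2.2 hi₀A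
  have hi₀B : i₀ ∉ A \ C := fun h => (mem_sdiff.mp h).2 hi₀C
  have hreassign := isAllocOn_reassign hdc hS hSmj' (A \ C)
  have hj : ∃ i ∈ A, j ∈ reassign S Smj (A \ C) i := by
    refine ⟨i₀, hi₀A, ?_⟩
    rw [reassign, if_neg hi₀B]
    refine mem_sdiff.mpr ⟨hji₀, fun h => ?_⟩
    obtain ⟨b, _, hb⟩ := mem_biUnion.mp h
    exact hjT b hb
  have hcoreassign : IsAllocOn (Finset.univ.erase j) I (coreassign S Smj (A \ C) C) := by
    refine isAllocOn_coreassign hdc hS hSmj (fun b hb => ?_) sdiff_disjoint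
      fun b hb c hc => (hclosed b hb c hc).1
    exact subset_erase.mpr ⟨subset_univ _, disjoint_left.mp
      (hS.2.2 i₀ b (ne_of_mem_of_not_mem hb hi₀B).symm) hji₀⟩
  have hsum := welfare_reassign_add_welfare_coreassign v (S := S) (T := Smj)
    (fun b hb c hc => (hclosed b hb c hc).2) fun i hiB hiC => by
      by_contra hne
      exact hiB (mem_sdiff.mpr ⟨by simp [hA, hne], hiC⟩)
  have hSeq : reassign S Smj (A \ C) = S := hSUniq _ hreassign hj <| by
    linarith [hSMax _ hreassign hj, hSmjMax _ hcoreassign]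
  have hrest : (A \ C).card ≤ ∑ i ∈ A \ C, (S i).card := by
    rw [card_eq_sum_ones]
    refine sum_le_sum fun i hi => card_pos.mpr (nonempty_iff_ne_empty.mpr ?_)
    rw [← hSeq, reassign, if_pos hi]
    have hiA := (mem_sdiff.mp hi).1
    rw [hA] at hiA
    exact (mem_filter.mp hiA).2
  have hcomp : C.card ≤ ∑ i ∈ C, (S i).card := by
    have hlt : (C.biUnion S ∩ C.biUnion Smj).card < (C.biUnion S).card := by
      refine card_lt_card ((ssubset_iff_of_subset inter_subset_left).mpr
        ⟨j, mem_biUnion.mpr ⟨i₀, hi₀C, hji₀⟩, fun h => ?_⟩)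
      obtain ⟨c, _, hc⟩ := mem_biUnion.mp (mem_inter.mp h).2
      exact hjT c hc
    have := card_biUnion_le (s := C) (t := S)
    omega
  have hAcard : A.card ≤ ∑ i ∈ A, (S i).card := by
    rw [← sum_sdiff hCA, ← card_sdiff_add_card_eq_card hCA]
    exact add_le_add hrest hcomp
  refine ⟨hAcard, ?_⟩
  have htotal : ∑ i, (S i).card ≤ m := by
    rw [← card_biUnion fun i _ i' _ hne => hS.2.2 i i' hne]
    simpa using card_le_univ (Finset.univ.biUnion S)
  rw [← sum_sdiff (subset_univ A)] at htotal
  omega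
end

section
/- Consider at least 2m bidders over m items, where each bidder i has its own downward-closed feasibility family 𝕀_i containing every singleton, strictly positive item values v_{ij}, and, for each item j, the values (v_{ij})_i are pairwise distinct. Let S* be a welfare-maximizing allocation and Ā the set of bidders receiving no item under S*. Then the VCG revenue at S* is at least Σ_{j=1}^m r_j(Ā). -/
open Finset
open scoped Classical BigOperators

/-- The iterative argmax-removal process: items are labeled `1, …, m`;
`sgt v S 0 = S`, and `sgt v S j` removes from `sgt v S (j-1)` the bidder(s) with
the highest value for item `j` (keeping exactly those bidders that are strictly
beaten by someone remaining). -/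
noncomputable def sgt {ι : Type*} [DecidableEq ι] (v : ι → ℕ → ℝ) (S : Finset ι) :
    ℕ → Finset ι
  | 0 => S
  | j + 1 => (sgt v S j).filter fun i => ∃ i' ∈ sgt v S j, v i (j + 1) < v i' (j + 1)

/-- `r_j(S) = v_{j*(S), j}`: the highest value for item `j` among `S_{>j-1}`. -/
noncomputable def rVal {ι : Type*} [DecidableEq ι] (v : ι → ℕ → ℝ) (S : Finset ι)
    (j : ℕ) : ℝ :=
  sSup {x : ℝ | ∃ i ∈ sgt v S (j - 1), v i j = x}

/-- `S` is an allocation of the items `{1, …, m}` to the bidders, where each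
bidder `i` must receive a set feasible for its own feasibility family `I i`. -/
def IsAllocN {ι : Type*} (m : ℕ) (I : ι → Set (Finset ℕ)) (S : ι → Finset ℕ) : Prop :=
  (∀ i, S i ∈ I i) ∧ (∀ i, S i ⊆ Finset.Icc 1 m) ∧
    ∀ i i' : ι, i ≠ i' → Disjoint (S i) (S i')

/-- The welfare of an allocation. -/
def welfareN {ι : Type*} [Fintype ι] (v : ι → ℕ → ℝ) (S : ι → Finset ℕ) : ℝ :=
  ∑ i, ∑ j ∈ S i, v i j

/-- The maximum welfare achievable by allocating only to the bidders other than `i`. -/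
noncomputable def maxWelfareWithoutN {ι : Type*} [Fintype ι] (m : ℕ)
    (I : ι → Set (Finset ℕ)) (v : ι → ℕ → ℝ) (i : ι) : ℝ :=
  sSup {w : ℝ | ∃ S, IsAllocN m I S ∧ S i = ∅ ∧ w = welfareN v S}

/-- The VCG revenue at allocation `S`. -/
noncomputable def vcgRevenueAtN {ι : Type*} [Fintype ι] [DecidableEq ι] (m : ℕ)
    (I : ι → Set (Finset ℕ)) (v : ι → ℕ → ℝ) (S : ι → Finset ℕ) : ℝ :=
  ∑ i, (maxWelfareWithoutN m I v i - ∑ i' ∈ Finset.univ.erase i, ∑ j ∈ S i', v i' j)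

theorem sgt_antitone {ι : Type*} [DecidableEq ι] (v : ι → ℕ → ℝ) (A : Finset ι) :
    Antitone (sgt v A) :=
  antitone_nat_of_succ_le fun _ => Finset.filter_subset _ _

/-- Removing the maximizers of an item with injective values removes at most one bidder. -/
theorem card_sgt_le_card_sgt_succ_add_one {ι : Type*} [DecidableEq ι] (v : ι → ℕ → ℝ)
    (A : Finset ι) (j : ℕ) (hinj : Function.Injective fun i => v i (j + 1)) :
    (sgt v A j).card ≤ (sgt v A (j + 1)).card + 1 := by
  rw [sgt, ← Finset.card_filter_add_card_filter_not (s := sgt v A j)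
    (fun i => ∃ i' ∈ sgt v A j, v i (j + 1) < v i' (j + 1))]
  gcongr
  refine Finset.card_le_one.2 fun a ha b hb => hinj ?_
  simp only [Finset.mem_filter, not_exists, not_and, not_lt] at ha hb
  exact le_antisymm (hb.2 a ha.1) (ha.2 b hb.1)

theorem card_le_card_sgt_add {ι : Type*} [DecidableEq ι] {m : ℕ} (v : ι → ℕ → ℝ)
    (A : Finset ι) (hinj : ∀ j ∈ Finset.Icc 1 m, Function.Injective fun i => v i j)
    (j : ℕ) (hj : j ≤ m) : A.card ≤ (sgt v A j).card + j := by
  induction j with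
  | zero => simp [sgt]
  | succ j ih =>
    have := card_sgt_le_card_sgt_succ_add_one v A j
      (hinj (j + 1) (Finset.mem_Icc.2 ⟨by omega, hj⟩))
    have := ih (by omega)
    omega

/-- Among at least `m` bidders, distinct bidders attain the values `r_j`. -/
theorem exists_injOn_rVal_eq {ι : Type*} [DecidableEq ι] [Nonempty ι] {m : ℕ} (v : ι → ℕ → ℝ)
    (A : Finset ι) (hA : m ≤ A.card)
    (hinj : ∀ j ∈ Finset.Icc 1 m, Function.Injective fun i => v i j) :
    ∃ w : ℕ → ι, (∀ j ∈ Finset.Icc 1 m, w j ∈ A ∧ v (w j) j = rVal v A j) ∧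
      Set.InjOn w (Finset.Icc 1 m) := by
  have key : ∀ j : ℕ, ∀ hj : j ∈ Finset.Icc 1 m, ∃ a, a ∈ sgt v A (j - 1) ∧ a ∉ sgt v A j ∧
      v a j = rVal v A j := by
    intro j hj
    obtain ⟨h1, hm⟩ := Finset.mem_Icc.1 hj
    obtain ⟨k, rfl⟩ := Nat.exists_eq_add_of_le' h1
    have hc := card_le_card_sgt_add v A hinj k (by omega)
    have hne : (sgt v A k).Nonempty := Finset.card_pos.1 (by omega)
    obtain ⟨a, ha, hmax⟩ := Finset.exists_max_image _ (fun i => v i (k + 1)) hne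
    refine ⟨a, ha, ?_, ?_⟩
    · rw [sgt, Finset.mem_filter]
      rintro ⟨-, b, hb, hlt⟩
      exact absurd (hmax b hb) (not_le.2 hlt)
    · have hg : IsGreatest {x : ℝ | ∃ i ∈ sgt v A (k + 1 - 1), v i (k + 1) = x} (v a (k + 1)) :=
        ⟨⟨a, ha, rfl⟩, by rintro _ ⟨b, hb, rfl⟩; exact hmax b hb⟩
      exact hg.csSup_eq.symm
  choose! w hw hw' hr using key
  refine ⟨w, fun j hj => ⟨sgt_antitone v A (Nat.zero_le _) (hw j hj), hr j hj⟩, ?_⟩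
  have hne : ∀ j ∈ Finset.Icc 1 m, ∀ k ∈ Finset.Icc 1 m, j < k → w j ≠ w k := by
    intro j hj k hk hjk h
    exact hw' j hj (sgt_antitone v A (by omega : j ≤ k - 1) (h ▸ hw k hk))
  intro j hj k hk h
  rcases lt_trichotomy j k with hjk | hjk | hjk
  · exact absurd h (hne j hj k hk hjk)
  · exact hjk
  · exact absurd h.symm (hne k hk j hj hjk)

/-- If some bidder wins nothing, a welfare-maximizing allocation leaves no item unsold. -/
theorem biUnion_eq_of_welfareN_max {ι : Type*} [Fintype ι] [DecidableEq ι] {m : ℕ}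
    (v : ι → ℕ → ℝ) (hv : ∀ i, ∀ j ∈ Finset.Icc 1 m, 0 < v i j)
    (I : ι → Set (Finset ℕ)) (hsing : ∀ i, ∀ j ∈ Finset.Icc 1 m, ({j} : Finset ℕ) ∈ I i)
    (S : ι → Finset ℕ) (hS : IsAllocN m I S)
    (hSMax : ∀ S', IsAllocN m I S' → welfareN v S' ≤ welfareN v S)
    (l : ι) (hl : S l = ∅) : Finset.univ.biUnion S = Finset.Icc 1 m := by
  refine (Finset.biUnion_subset.2 fun i _ => hS.2.1 i).antisymm fun j hj => ?_
  by_contra hjU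
  have hjS : ∀ i, j ∉ S i := by simpa using hjU
  have halloc : IsAllocN m I (Function.update S l {j}) := by
    refine ⟨fun i => ?_, fun i => ?_, fun i i' hii => ?_⟩
    · by_cases h : i = l
      · subst h; simpa using hsing i j hj
      · simpa [h] using hS.1 i
    · by_cases h : i = l
      · subst h; simpa using hj
      · simpa [h] using hS.2.1 i
    · by_cases h : i = l
      · subst h; simpa [hii.symm] using hjS i'
      · by_cases h' : i' = l
        · subst h'; simpa [h] using hjS i
        · simpa [h, h'] using hS.2.2 i i' hii
  refine absurd (hSMax _ halloc) (not_le.2 ?_)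
  refine Finset.sum_lt_sum (fun i _ => ?_) ⟨l, Finset.mem_univ l, ?_⟩
  · by_cases h : i = l
    · subst h; simpa [hl] using (hv i j hj).le
    · simp [h]
  · simpa [hl] using hv l j hj

theorem card_filter_ne_empty_le {ι : Type*} [Fintype ι] [DecidableEq ι] {m : ℕ}
    (I : ι → Set (Finset ℕ)) (S : ι → Finset ℕ) (hS : IsAllocN m I S) :
    (Finset.univ.filter fun i => ¬ S i = ∅).card ≤ m := by
  calc (Finset.univ.filter fun i => ¬ S i = ∅).card
      = ∑ i ∈ Finset.univ.filter fun i => ¬ S i = ∅, 1 := by simp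
    _ ≤ ∑ i ∈ Finset.univ.filter fun i => ¬ S i = ∅, (S i).card :=
        Finset.sum_le_sum fun i hi =>
          Finset.card_pos.2 (Finset.nonempty_iff_ne_empty.2 (Finset.mem_filter.1 hi).2)
    _ ≤ ∑ i, (S i).card := Finset.sum_le_sum_of_subset (Finset.subset_univ _)
    _ = (Finset.univ.biUnion S).card :=
        (Finset.card_biUnion fun i _ i' _ h => hS.2.2 i i' h).symm
    _ ≤ (Finset.Icc 1 m).card :=
        Finset.card_le_card (Finset.biUnion_subset.2 fun i _ => hS.2.1 i)
    _ = m := by simp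

/-- Handing the items of bidder `i` one by one to distinct losing bidders `w j` gives a lower
bound on the welfare achievable without `i`. -/
theorem sum_le_maxWelfareWithoutN {ι : Type*} [Fintype ι] [DecidableEq ι] {m : ℕ}
    (v : ι → ℕ → ℝ) (I : ι → Set (Finset ℕ))
    (hdc : ∀ i, ∀ T T' : Finset ℕ, T ⊆ T' → T' ∈ I i → T ∈ I i)
    (hsing : ∀ i, ∀ j ∈ Finset.Icc 1 m, ({j} : Finset ℕ) ∈ I i)
    (S : ι → Finset ℕ) (hS : IsAllocN m I S)
    (hSMax : ∀ S', IsAllocN m I S' → welfareN v S' ≤ welfareN v S)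
    (w : ℕ → ι) (hw : ∀ j ∈ Finset.Icc 1 m, S (w j) = ∅)
    (hwinj : Set.InjOn w (Finset.Icc 1 m)) (i : ι) :
    (∑ i' ∈ Finset.univ.erase i, ∑ j ∈ S i', v i' j) + ∑ j ∈ S i, v (w j) j
      ≤ maxWelfareWithoutN m I v i := by
  set B : ι → Finset ℕ := fun i' => if i' = i then ∅ else S i' with hB
  set F : ι → Finset ℕ := fun i' => (S i).filter fun j => w j = i' with hF
  have hFsub : ∀ i', F i' ⊆ S i := fun i' => Finset.filter_subset _ _
  have hBsub : ∀ i', B i' ⊆ S i' := fun i' => by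
    by_cases h : i' = i <;> simp [hB, h]
  have hBF : ∀ a b, Disjoint (B a) (F b) := fun a b => by
    by_cases h : a = i
    · simp [hB, h]
    · exact (hS.2.2 a i h).mono (hBsub a) (hFsub b)
  have hFne : ∀ i', S i' ≠ ∅ → F i' = ∅ := fun i' h =>
    Finset.filter_eq_empty_iff.2 fun j hj hji => h (hji ▸ hw j (hS.2.1 i hj))
  have hempty : ∀ i', (∅ : Finset ℕ) ∈ I i' := fun i' => hdc i' _ _ (by simp) (hS.1 i')
  have hFmem : ∀ i', F i' ∈ I i' := fun i' => by
    rcases (F i').eq_empty_or_nonempty with h | ⟨j, hj⟩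
    · rw [h]; exact hempty i'
    · have hjm := hS.2.1 i (hFsub i' hj)
      refine hdc i' _ {j} (fun k hk => Finset.mem_singleton.2 ?_) (hsing i' j hjm)
      exact hwinj (hS.2.1 i (hFsub i' hk)) hjm
        ((Finset.mem_filter.1 hk).2.trans (Finset.mem_filter.1 hj).2.symm)
  have halloc : IsAllocN m I fun i' => B i' ∪ F i' := by
    refine ⟨fun i' => ?_, fun i' => ?_, fun a b hab => ?_⟩
    · by_cases h : S i' = ∅
      · have : B i' = ∅ := Finset.subset_empty.1 (h ▸ hBsub i')
        simpa [this] using hFmem i'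
      · simpa [hFne i' h] using hdc i' _ _ (hBsub i') (hS.1 i')
    · exact Finset.union_subset ((hBsub i').trans (hS.2.1 i')) ((hFsub i').trans (hS.2.1 i))
    · refine Finset.disjoint_union_left.2 ⟨Finset.disjoint_union_right.2 ⟨?_, hBF a b⟩,
        Finset.disjoint_union_right.2 ⟨(hBF b a).symm, ?_⟩⟩
      · exact (hS.2.2 a b hab).mono (hBsub a) (hBsub b)
      · refine Finset.disjoint_left.2 fun j ha hb => hab ?_
        exact (Finset.mem_filter.1 ha).2.symm.trans (Finset.mem_filter.1 hb).2
  have hi : B i ∪ F i = ∅ := by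
    by_cases h : S i = ∅
    · simp [hB, hF, h]
    · simp [hB, hFne i h]
  have hBw : ∑ i', ∑ j ∈ B i', v i' j = ∑ i' ∈ Finset.univ.erase i, ∑ j ∈ S i', v i' j := by
    rw [← Finset.add_sum_erase _ _ (Finset.mem_univ i)]
    simp only [hB, if_true, Finset.sum_empty, zero_add]
    refine Finset.sum_congr rfl fun i' h => ?_
    rw [if_neg (Finset.ne_of_mem_erase h)]
  have hFw : ∑ i', ∑ j ∈ F i', v i' j = ∑ j ∈ S i, v (w j) j := by
    rw [← Finset.sum_fiberwise (S i) w]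
    refine Finset.sum_congr rfl fun i' _ => Finset.sum_congr rfl fun j hj => ?_
    rw [(Finset.mem_filter.1 hj).2]
  refine le_csSup ⟨welfareN v S, ?_⟩ ⟨_, halloc, hi, ?_⟩
  · rintro _ ⟨S', hS', -, rfl⟩
    exact hSMax S' hS'
  · rw [welfareN, ← hBw, ← hFw, ← Finset.sum_add_distrib]
    exact Finset.sum_congr rfl fun a _ => (Finset.sum_union (hBF a a)).symm

/-- Lemma E.1 (lem:vcg_rev_asym): with at least `2m` bidders, each with its own
downward-closed feasibility family containing every singleton, strictly positive
per-item-injective values, the VCG revenue at a welfare-maximizing allocation `S`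
is at least `Σ_{j=1}^m r_j(Ā)`, where `Ā` is the set of unallocated bidders. -/
theorem stmt13 {ι : Type*} [Fintype ι] [DecidableEq ι] {m : ℕ}
    (hcard : 2 * m ≤ Fintype.card ι)
    (v : ι → ℕ → ℝ)
    (hv : ∀ i, ∀ j ∈ Finset.Icc 1 m, 0 < v i j)
    (hinj : ∀ j ∈ Finset.Icc 1 m, Function.Injective fun i => v i j)
    (I : ι → Set (Finset ℕ))
    (hdc : ∀ i, ∀ T T' : Finset ℕ, T ⊆ T' → T' ∈ I i → T ∈ I i)
    (hsing : ∀ i, ∀ j ∈ Finset.Icc 1 m, ({j} : Finset ℕ) ∈ I i)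
    (S : ι → Finset ℕ)
    (hS : IsAllocN m I S)
    (hSMax : ∀ S', IsAllocN m I S' → welfareN v S' ≤ welfareN v S) :
    (∑ j ∈ Finset.Icc 1 m, rVal v (Finset.univ.filter fun i => S i = ∅) j)
      ≤ vcgRevenueAtN m I v S := by
  rcases isEmpty_or_nonempty ι with hι | hι
  · have : m = 0 := by simpa using hcard
    simp [this, vcgRevenueAtN]
  set A := Finset.univ.filter fun i => S i = ∅ with hA
  have hAcard : Fintype.card ι ≤ A.card + m := by
    rw [← Finset.card_univ, ← Finset.card_filter_add_card_filter_not (fun i => S i = ∅)]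
    exact Nat.add_le_add_left (card_filter_ne_empty_le I S hS) _
  obtain ⟨w, hw, hwinj⟩ := exists_injOn_rVal_eq (m := m) v A (by omega) hinj
  have hwS : ∀ j ∈ Finset.Icc 1 m, S (w j) = ∅ := fun j hj =>
    (Finset.mem_filter.1 (hw j hj).1).2
  have hAne : A.Nonempty := by
    have := Fintype.card_pos (α := ι)
    exact Finset.card_pos.1 (by omega)
  obtain ⟨l, hl⟩ := hAne
  have hU := biUnion_eq_of_welfareN_max v hv I hsing S hS hSMax l (Finset.mem_filter.1 hl).2
  rw [← hU, Finset.sum_biUnion fun i _ i' _ h => hS.2.2 i i' h, vcgRevenueAtN]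
  refine Finset.sum_le_sum fun i _ => ?_
  have hi := sum_le_maxWelfareWithoutN v I hdc hsing S hS hSMax w hwS hwinj i
  rw [Finset.sum_congr rfl fun j hj => (hw j (hS.2.1 i hj)).2] at hi
  linarith
end

section
/- Let N be a finite set of bidders with item values v : N × {1,…,m} → ℝ such that for each item j the map i ↦ v_{ij} is injective. For subsets S ⊆ T ⊆ N with |S| ≥ m, and for every j ∈ {1,…,m}: S_{>j−1} ⊆ T_{>j−1}, where the sets S_{>j} are defined by the iterative argmax-removal process. -/
open Finset
open scoped Classical BigOperators

/-- The argmax-removal process is monotone in the initial set of bidders. -/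
theorem sgt_mono {ι : Type*} [DecidableEq ι] (v : ι → ℕ → ℝ) {S T : Finset ι}
    (hST : S ⊆ T) (k : ℕ) : sgt v S k ⊆ sgt v T k := by
  induction k with
  | zero => exact hST
  | succ k ih =>
    intro i hi
    simp only [sgt, Finset.mem_filter] at hi ⊢
    obtain ⟨hi, i', hi', hlt⟩ := hi
    exact ⟨ih hi, i', ih hi', hlt⟩

/-- Lemma E.3 (lem:payment_prop): for subsets `S ⊆ T` of the bidders with
`|S| ≥ m`, and per-item-injective values, the argmax-removal process is monotone:
`S_{>j-1} ⊆ T_{>j-1}` for every item `j ∈ {1, …, m}`. -/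
theorem stmt14 {ι : Type*} [Fintype ι] [DecidableEq ι] {m : ℕ}
    (v : ι → ℕ → ℝ)
    (hinj : ∀ j ∈ Finset.Icc 1 m, Function.Injective fun i => v i j)
    (S T : Finset ι) (hST : S ⊆ T) (hScard : m ≤ S.card)
    (j : ℕ) (hj : j ∈ Finset.Icc 1 m) :
    sgt v S (j - 1) ⊆ sgt v T (j - 1) := by
  exact sgt_mono v hST (j - 1)
end

section
/- Consider strictly more bidders than items, where each bidder i has its own downward-closed feasibility family 𝕀_i containing every singleton and strictly positive item values v_{ij} over m items. Let S* be a welfare-maximizing MATCHING allocation (each bidder receives at most one item; it then allocates every item), let Ā be the set of bidders receiving no item under S*, and for each item j let v*_j = max_{i ∈ Ā} v_{ij}. Then the revenue of the matching-restricted VCG mechanism at S* is at least Σ_{j=1}^m v*_j. -/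
open Finset
open scoped Classical BigOperators

/-- `S` is a matching allocation: each bidder gets at most one item, and distinct
bidders get distinct items. -/
def IsMatching {N m : ℕ} (S : Fin N → Option (Fin m)) : Prop :=
  ∀ i i' j, S i = some j → S i' = some j → i = i'

/-- The welfare of a matching allocation. -/
def matchWelfare {N m : ℕ} (v : Fin N → Fin m → ℝ) (S : Fin N → Option (Fin m)) : ℝ :=
  ∑ i, (S i).elim 0 (v i)

/-- The maximum matching welfare achievable among the bidders other than `i`. -/
noncomputable def maxMatchWelfareWithout {N m : ℕ} (v : Fin N → Fin m → ℝ)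
    (i : Fin N) : ℝ :=
  sSup {w : ℝ | ∃ S, IsMatching S ∧ S i = none ∧ w = matchWelfare v S}

/-- The revenue of the matching-restricted (maximal-in-range) VCG mechanism at the
matching `S`: bidder `i` pays `maxMatchWelfareWithout i` minus the welfare of `S`
excluding bidder `i`'s item. -/
noncomputable def mirRevenueAt {N m : ℕ} (v : Fin N → Fin m → ℝ)
    (S : Fin N → Option (Fin m)) : ℝ :=
  ∑ i, (maxMatchWelfareWithout v i - ∑ i' ∈ Finset.univ.erase i, (S i').elim 0 (v i'))

/-- Handing an unassigned item `j` to an unallocated bidder `k` keeps a matching. -/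
theorem IsMatching.update_some {N m : ℕ} {S : Fin N → Option (Fin m)} (hS : IsMatching S)
    (k : Fin N) {j : Fin m} (hj : ∀ i, S i ≠ some j) :
    IsMatching (Function.update S k (some j)) := by
  intro a b l ha hb
  have key := hS a b l
  simp only [Function.update_apply] at ha hb
  grind

/-- Taking away bidder `i`'s item keeps a matching. -/
theorem IsMatching.update_none {N m : ℕ} {S : Fin N → Option (Fin m)} (hS : IsMatching S)
    (i : Fin N) : IsMatching (Function.update S i none) := by
  intro a b l ha hb
  have key := hS a b l
  simp only [Function.update_apply] at ha hb
  grind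

theorem matchWelfare_eq_add_sum_erase {N m : ℕ} (v : Fin N → Fin m → ℝ)
    (S : Fin N → Option (Fin m)) (i : Fin N) :
    matchWelfare v S =
      (S i).elim 0 (v i) + ∑ i' ∈ Finset.univ.erase i, (S i').elim 0 (v i') :=
  (Finset.add_sum_erase _ _ (Finset.mem_univ i)).symm

theorem matchWelfare_update {N m : ℕ} (v : Fin N → Fin m → ℝ)
    (S : Fin N → Option (Fin m)) (i : Fin N) (o : Option (Fin m)) :
    matchWelfare v (Function.update S i o) =
      o.elim 0 (v i) + ∑ i' ∈ Finset.univ.erase i, (S i').elim 0 (v i') := by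
  rw [matchWelfare_eq_add_sum_erase v _ i, Function.update_self]
  congr 1
  refine Finset.sum_congr rfl fun a ha => ?_
  rw [Function.update_of_ne (Finset.ne_of_mem_erase ha)]

theorem matchWelfare_update_some {N m : ℕ} (v : Fin N → Fin m → ℝ)
    {S : Fin N → Option (Fin m)} {k : Fin N} (hk : S k = none) (j : Fin m) :
    matchWelfare v (Function.update S k (some j)) = v k j + matchWelfare v S := by
  rw [matchWelfare_update, matchWelfare_eq_add_sum_erase v S k, hk]
  simp

/-- With more bidders than items, every matching leaves some bidder unallocated. -/
theorem IsMatching.exists_eq_none {N m : ℕ} (hNm : m < N) {S : Fin N → Option (Fin m)}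
    (hS : IsMatching S) : ∃ k, S k = none := by
  by_contra! h
  choose f hf using fun i => Option.ne_none_iff_exists'.mp (h i)
  have hinj : Function.Injective f := fun a b hab => hS a b (f a) (hf a) (hab ▸ hf b)
  have := Fintype.card_le_of_injective f hinj
  simp only [Fintype.card_fin] at this
  omega

/-- If the welfare of matchings is bounded by `B`, the maximum welfare without bidder `i`
dominates the welfare of every matching not serving `i`. -/
theorem matchWelfare_le_maxMatchWelfareWithout {N m : ℕ} {v : Fin N → Fin m → ℝ} {B : ℝ}
    (hB : ∀ S, IsMatching S → matchWelfare v S ≤ B) {S : Fin N → Option (Fin m)}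
    (hS : IsMatching S) {i : Fin N} (hi : S i = none) :
    matchWelfare v S ≤ maxMatchWelfareWithout v i :=
  le_csSup ⟨B, by rintro w ⟨T, hT, -, rfl⟩; exact hB T hT⟩ ⟨S, hS, hi, rfl⟩

/-- Observation of Appendix E.1: with strictly more bidders than items (each with its
own downward-closed feasibility family containing every singleton, and strictly
positive values), the matching-restricted VCG revenue at a welfare-maximizing
matching `S` is at least `Σ_j v*_j`, where `v*_j` is the highest value for item `j`
among the bidders receiving no item under `S`. -/
theorem stmt16 {N m : ℕ} (hNm : m < N)
    (v : Fin N → Fin m → ℝ) (hv : ∀ i j, 0 < v i j)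
    (I : Fin N → Set (Finset (Fin m)))
    (hdc : ∀ i, ∀ T T' : Finset (Fin m), T ⊆ T' → T' ∈ I i → T ∈ I i)
    (hsing : ∀ i, ∀ j : Fin m, ({j} : Finset (Fin m)) ∈ I i)
    (S : Fin N → Option (Fin m))
    (hS : IsMatching S)
    (hSMax : ∀ S', IsMatching S' → matchWelfare v S' ≤ matchWelfare v S) :
    (∑ j : Fin m, sSup {x : ℝ | ∃ i, S i = none ∧ x = v i j}) ≤ mirRevenueAt v S := by
  obtain ⟨k₀, hk₀⟩ := hS.exists_eq_none hNm
  have halloc : ∀ j, ∃ i, S i = some j := by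
    by_contra! h
    obtain ⟨j, hj⟩ := h
    have := hSMax _ (hS.update_some k₀ hj)
    rw [matchWelfare_update_some v hk₀] at this
    linarith [hv k₀ j]
  choose o ho using halloc
  have hinj : Function.Injective o := fun a b hab =>
    Option.some_injective _ (by rw [← ho a, ← ho b, hab])
  have hrest : ∀ i, ∑ i' ∈ Finset.univ.erase i, (S i').elim 0 (v i') =
      matchWelfare v (Function.update S i none) := fun i => by
    rw [matchWelfare_update]; simp
  unfold mirRevenueAt
  calc ∑ j : Fin m, sSup {x : ℝ | ∃ i, S i = none ∧ x = v i j}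
      ≤ ∑ j : Fin m, (maxMatchWelfareWithout v (o j) -
          ∑ i' ∈ Finset.univ.erase (o j), (S i').elim 0 (v i')) := by
        refine Finset.sum_le_sum fun j _ => csSup_le ⟨_, k₀, hk₀, rfl⟩ ?_
        rintro _ ⟨k, hk, rfl⟩
        have hne : o j ≠ k := fun h => by simp [← h, ho] at hk
        have hfree : ∀ i, Function.update S (o j) none i ≠ some j := by
          intro i hi
          by_cases h : i = o j
          · simp [h] at hi
          · rw [Function.update_of_ne h] at hi
            exact h (hS _ _ _ hi (ho j))
        have hk' : Function.update S (o j) none k = none := by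
          rw [Function.update_of_ne hne.symm, hk]
        have hle := matchWelfare_le_maxMatchWelfareWithout hSMax
          ((hS.update_none (o j)).update_some k hfree) (i := o j)
          (by rw [Function.update_of_ne hne, Function.update_self])
        rw [matchWelfare_update_some v hk'] at hle
        rw [hrest]
        linarith
    _ = ∑ i ∈ Finset.univ.map ⟨o, hinj⟩, (maxMatchWelfareWithout v i -
          ∑ i' ∈ Finset.univ.erase i, (S i').elim 0 (v i')) :=
        by rw [Finset.sum_map]; rfl
    _ ≤ _ := by
        refine Finset.sum_le_univ_sum_of_nonneg fun i => ?_
        rw [hrest]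
        exact sub_nonneg.mpr (matchWelfare_le_maxMatchWelfareWithout hSMax
          (hS.update_none i) (Function.update_self ..))
end
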